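/- Let k ≥ 1 be an integer, let α_i = -1 + 2i/k for i = 0,…,k, let μ ∈ ℝ and σ > 0, and let p̃_i = Φ_{μ,σ}(α_i) − Φ_{μ,σ}(α_{i−1}). If 1 ≤ i ≤ k−1 and μ ≥ α_{i+1}, then p̃_{i+1} > p̃_i. -/

import Mathlib

open MeasureTheory ProbabilityTheory

/-- `Phi μ σ t` is the CDF of the normal distribution `N(μ, σ²)` evaluated at `t`. -/
noncomputable def Phi (μ σ : ℝ) (t : ℝ) : ℝ :=
  ((gaussianReal μ (σ ^ 2).toNNReal) (Set.Iic t)).toReal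

theorem strictMonoOn_gaussianPDFReal (μ : ℝ) {v : NNReal} (hv : v ≠ 0) :
    StrictMonoOn (gaussianPDFReal μ v) (Set.Iic μ) := by
  intro x _ y hy hxy
  have hv' : (0 : ℝ) < v := by positivity
  have hy' : y ≤ μ := hy
  simp only [gaussianPDFReal_def]
  gcongr ?_ * Real.exp (?_ / _)
  nlinarith

theorem continuous_gaussianPDFReal (μ : ℝ) (v : NNReal) :
    Continuous (gaussianPDFReal μ v) := by
  rw [gaussianPDFReal_def]
  fun_prop

theorem Phi_eq_integral (μ : ℝ) {σ : ℝ} (hσ : 0 < σ) (t : ℝ) :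
    Phi μ σ t = ∫ x in Set.Iic t, gaussianPDFReal μ (σ ^ 2).toNNReal x := by
  have hv : (σ ^ 2).toNNReal ≠ 0 := (Real.toNNReal_pos.2 (by positivity)).ne'
  rw [Phi, gaussianReal_apply_eq_integral μ hv, ENNReal.toReal_ofReal]
  exact integral_nonneg fun x => gaussianPDFReal_nonneg μ _ x

theorem Phi_sub_Phi (μ : ℝ) {σ : ℝ} (hσ : 0 < σ) (a b : ℝ) :
    Phi μ σ b - Phi μ σ a = ∫ x in a..b, gaussianPDFReal μ (σ ^ 2).toNNReal x := by
  rw [Phi_eq_integral μ hσ, Phi_eq_integral μ hσ]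
  exact intervalIntegral.integral_Iic_sub_Iic
    (integrable_gaussianPDFReal μ _).integrableOn (integrable_gaussianPDFReal μ _).integrableOn

/-- Of two adjacent intervals of equal length to the left of the mean, the right one has
strictly larger Gaussian mass. -/
theorem Phi_sub_lt_Phi_sub {μ σ : ℝ} (hσ : 0 < σ) {a d : ℝ} (hd : 0 < d)
    (h : a + d + d ≤ μ) :
    Phi μ σ (a + d) - Phi μ σ a < Phi μ σ (a + d + d) - Phi μ σ (a + d) := by
  have hv : (σ ^ 2).toNNReal ≠ 0 := (Real.toNNReal_pos.2 (by positivity)).ne'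
  have hc := continuous_gaussianPDFReal μ (σ ^ 2).toNNReal
  have hlt : ∀ x ≤ a + d, gaussianPDFReal μ (σ ^ 2).toNNReal x <
      gaussianPDFReal μ (σ ^ 2).toNNReal (x + d) := fun x hx =>
    strictMonoOn_gaussianPDFReal μ hv (Set.mem_Iic.2 (by linarith))
      (Set.mem_Iic.2 (by linarith)) (by linarith)
  rw [Phi_sub_Phi μ hσ, Phi_sub_Phi μ hσ, ← intervalIntegral.integral_comp_add_right]
  refine intervalIntegral.integral_lt_integral_of_continuousOn_of_le_of_exists_lt
    (by linarith) hc.continuousOn (hc.comp (continuous_add_const d)).continuousOn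
    (fun x hx => (hlt x hx.2).le)
    ⟨a, Set.left_mem_Icc.2 (by linarith), hlt a (by linarith)⟩

theorem stmt_3 (k : ℕ) (hk : 1 ≤ k) (μ σ : ℝ) (hσ : 0 < σ)
    (α : ℕ → ℝ) (hα : ∀ i, α i = -1 + 2 * (i : ℝ) / (k : ℝ))
    (ptilde : ℕ → ℝ)
    (hpt : ∀ i, ptilde i = Phi μ σ (α i) - Phi μ σ (α (i - 1)))
    (i : ℕ) (hi1 : 1 ≤ i) (hik : i + 1 ≤ k) (hμ : μ ≥ α (i + 1)) :
    ptilde (i + 1) > ptilde i := by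
  have hk0 : (0 : ℝ) < k := by exact_mod_cast hk
  have hstep : ∀ j, α (j + 1) = α j + 2 / k := fun j => by
    rw [hα, hα]
    push_cast
    ring
  obtain ⟨j, rfl⟩ := Nat.exists_eq_add_of_le' hi1
  rw [hpt, hpt, Nat.add_sub_cancel, Nat.add_sub_cancel, hstep (j + 1), hstep j]
  rw [hstep (j + 1), hstep j] at hμ
  exact Phi_sub_lt_Phi_sub hσ (by positivity) hμ
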